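/- Let Γ be an abelian group isomorphic, as an abstract group, to ℚ/ℤ. Then (a) the set of cyclic orders on Γ is uncountable, and (b) any two cyclic orders on Γ are c-isomorphic: for all cyclic orders R and R' on Γ there exists a group automorphism φ of Γ such that R(a,b,c) holds if and only if R'(φ(a),φ(b),φ(c)) holds, for all a,b,c. -/

import Mathlib

/-- A cyclic order on an (additive) abelian group: a ternary relation that is strict, cyclic,
such that the induced binary relation at each point is transitive and total on distinct triples,
and which is compatible with translation. -/
def IsCyclicOrder {G : Type*} [AddCommGroup G] (R : G → G → G → Prop) : Prop :=
  (∀ a b c : G, R a b c → a ≠ b ∧ b ≠ c ∧ c ≠ a) ∧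
  (∀ a b c : G, R a b c → R b c a) ∧
  (∀ a b c d : G, R a b c → R a c d → R a b d) ∧
  (∀ a b c : G, a ≠ b → b ≠ c → c ≠ a → R a b c ∨ R a c b) ∧
  (∀ a b c x : G, R a b c → R (a + x) (b + x) (c + x))

namespace IsCyclicOrder

variable {G : Type*} [AddCommGroup G] {R : G → G → G → Prop}

theorem rotate (h : IsCyclicOrder R) {a b c : G} (habc : R a b c) : R b c a :=
  h.2.1 a b c habc

theorem trans (h : IsCyclicOrder R) {a b c d : G} (habc : R a b c) (hacd : R a c d) : R a b d :=
  h.2.2.1 a b c d habc hacd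

theorem asymm (h : IsCyclicOrder R) {a b c : G} (habc : R a b c) : ¬ R a c b := fun hacb =>
  (h.1 a b b (h.trans habc hacb)).2.1 rfl

theorem total (h : IsCyclicOrder R) {a b c : G} (hab : a ≠ b) (hbc : b ≠ c) (hca : c ≠ a) :
    R a b c ∨ R a c b :=
  h.2.2.2.1 a b c hab hbc hca

theorem translate (h : IsCyclicOrder R) {a b c : G} (habc : R a b c) (x : G) :
    R (a + x) (b + x) (c + x) :=
  h.2.2.2.2 a b c x habc

/-- A cyclic order contained in another one is equal to it. -/
theorem iff_of_imp {R' : G → G → G → Prop} (h : IsCyclicOrder R) (h' : IsCyclicOrder R')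
    (himp : ∀ a b c, R a b c → R' a b c) (a b c : G) : R a b c ↔ R' a b c := by
  refine ⟨himp a b c, fun hr => ?_⟩
  obtain ⟨hab, hbc, hca⟩ := h'.1 a b c hr
  exact (h.total hab hbc hca).resolve_right fun hacb => h'.asymm hr (himp _ _ _ hacb)

/-- A nonempty finite set has a first element as seen from any point outside it. -/
theorem exists_first (h : IsCyclicOrder R) (o : G) (s : Finset G) (hs : s.Nonempty)
    (ho : o ∉ s) : ∃ g ∈ s, ∀ x ∈ s, x ≠ g → R o g x := by
  induction hs using Finset.Nonempty.cons_induction with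
  | singleton a => exact ⟨a, by simp, by simp +contextual⟩
  | cons a s ha hs ih =>
    simp only [Finset.mem_cons, not_or] at ho
    obtain ⟨g, hg, hmin⟩ := ih ho.2
    have hog : o ≠ g := fun e => ho.2 (e ▸ hg)
    have hga : g ≠ a := fun e => ha (e ▸ hg)
    rcases h.total hog hga (Ne.symm ho.1) with hr | hr
    · refine ⟨g, by simp [hg], fun x hx hxg => ?_⟩
      rcases Finset.mem_cons.1 hx with rfl | hx
      · exact hr
      · exact hmin x hx hxg
    · refine ⟨a, by simp, fun x hx hxa => ?_⟩
      have hx := (Finset.mem_cons.1 hx).resolve_left hxa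
      by_cases hxg : x = g
      · exact hxg ▸ hr
      · exact h.trans hr (hmin x hx hxg)

/-- If `g` is the first nonzero element of a subgroup `T`, then its multiples follow each other
in the order, and any other element of `T` comes later. -/
theorem nsmul_of_first (h : IsCyclicOrder R) (T : AddSubgroup G) {g : G} (hg : g ∈ T)
    (hmin : ∀ x ∈ T, x ≠ 0 → x ≠ g → R 0 g x) (k : ℕ) {y : G} (hy : y ∈ T)
    (hyk : ∀ i, i ≤ k + 1 → y ≠ i • g) : R 0 ((k + 1) • g) y := by
  induction k with
  | zero =>
    simpa using hmin y hy (by simpa using hyk 0 (by simp)) (by simpa using hyk 1 (by simp))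
  | succ k ih =>
    have h₁ : R 0 ((k + 1) • g) y := ih (fun i hik => hyk i (by omega))
    have h₂ : R ((k + 1) • g) ((k + 1 + 1) • g) y := by
      have := h.translate (hmin (y - (k + 1) • g) (T.sub_mem hy (T.nsmul_mem hg _))
        (sub_ne_zero.2 (hyk _ (by omega)))
        (fun e => hyk (k + 1 + 1) le_rfl (by rw [succ_nsmul', ← sub_eq_iff_eq_add, e])))
        ((k + 1) • g)
      rwa [zero_add, sub_add_cancel, ← succ_nsmul'] at this
    exact h.rotate (h.trans (h.rotate (h.rotate h₁)) (h.rotate (h.rotate h₂)))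

/-- A finite subgroup `T` is generated by its first nonzero element, whose multiples are met in
increasing order. -/
theorem exists_generator (h : IsCyclicOrder R) (T : AddSubgroup G) (hT : (T : Set G).Finite) :
    ∃ g ∈ T, (∀ x ∈ T, ∃ k < addOrderOf g, k • g = x) ∧
      ∀ j k, 0 < j → j < k → k < addOrderOf g → R 0 (j • g) (k • g) := by
  classical
  by_cases hbot : ∀ x ∈ T, x = 0
  · exact ⟨0, T.zero_mem, fun x hx => ⟨0, by simp, by simp [hbot x hx]⟩, by simp; omega⟩
  push Not at hbot
  obtain ⟨x₀, hx₀, hne⟩ := hbot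
  obtain ⟨g, hg, hmin⟩ := h.exists_first 0 (hT.toFinset.erase 0) ⟨x₀, by simp [hx₀, hne]⟩ (by simp)
  simp only [Finset.mem_erase, Set.Finite.mem_toFinset, SetLike.mem_coe] at hg hmin
  obtain ⟨hg0, hgT⟩ := hg
  have hmin' : ∀ x ∈ T, x ≠ 0 → x ≠ g → R 0 g x := fun x hx h0 => hmin x ⟨h0, hx⟩
  have hpos : 0 < addOrderOf g := by
    have : Finite T := hT
    have := (isOfFinAddOrder_of_finite (⟨g, hgT⟩ : T)).addOrderOf_pos
    rwa [← AddSubgroup.addOrderOf_coe] at this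
  have hone : addOrderOf g ≠ 1 := fun e => hg0 (AddMonoid.addOrderOf_eq_one_iff.1 e)
  refine ⟨g, hgT, fun x hx => ?_, fun j k hj hjk hk => ?_⟩
  · by_contra! hcon
    obtain ⟨d, hd⟩ : ∃ d, addOrderOf g = d + 1 + 1 := ⟨addOrderOf g - 2, by omega⟩
    have h₁ : R 0 ((d + 1) • g) x :=
      h.nsmul_of_first T hgT hmin' d hx fun i hi => (hcon i (by omega)).symm
    have h₂ := h.translate (hmin' (x - (d + 1) • g) (T.sub_mem hx (T.nsmul_mem hgT _))
        (sub_ne_zero.2 (hcon _ (by omega)).symm)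
        (fun e => hcon 0 hpos (by
          rw [sub_eq_iff_eq_add, ← succ_nsmul', ← hd, addOrderOf_nsmul_eq_zero] at e
          simp [e]))) ((d + 1) • g)
    rw [zero_add, sub_add_cancel, ← succ_nsmul', ← hd, addOrderOf_nsmul_eq_zero] at h₂
    exact h.asymm h₁ (h.rotate h₂)
  · obtain ⟨i, rfl⟩ : ∃ i, j = i + 1 := ⟨j - 1, by omega⟩
    refine h.nsmul_of_first T hgT hmin' i (T.nsmul_mem hgT _) fun l hl e => ?_
    have := nsmul_injOn_Iio_addOrderOf (Set.mem_Iio.2 hk) (Set.mem_Iio.2 (by omega)) e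
    omega

end IsCyclicOrder

/-- A homomorphism `ℚ →+ G` identifying `G` with `ℚ/ℤ`. -/
def IsRatCover {G : Type*} [AddCommGroup G] (ψ : ℚ →+ G) : Prop :=
  Function.Surjective ψ ∧ ∀ q, ψ q = 0 ↔ ∃ n : ℤ, (n : ℚ) = q

/-- The cyclic order transported from the natural one on `ℚ/ℤ` along `ψ`. -/
def inducedCyclicOrder {G : Type*} [AddCommGroup G] (ψ : ℚ →+ G) (a b c : G) : Prop :=
  ∃ s t : ℚ, 0 < s ∧ s < t ∧ t < 1 ∧ ψ s = b - a ∧ ψ t = c - a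

namespace IsRatCover

variable {G : Type*} [AddCommGroup G] {ψ : ℚ →+ G}

theorem map_one (hψ : IsRatCover ψ) : ψ 1 = 0 := (hψ.2 1).2 ⟨1, by simp⟩

theorem map_ne_zero (hψ : IsRatCover ψ) {s : ℚ} (h0 : 0 < s) (h1 : s < 1) : ψ s ≠ 0 := by
  intro h
  obtain ⟨n, rfl⟩ := (hψ.2 s).1 h
  have h0 : 0 < n := by exact_mod_cast h0
  have h1 : n < 1 := by exact_mod_cast h1
  omega

theorem eq_of_map_eq (hψ : IsRatCover ψ) {s t : ℚ} (hs0 : 0 < s) (hs1 : s < 1) (ht0 : 0 < t)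
    (ht1 : t < 1) (h : ψ s = ψ t) : s = t := by
  rcases lt_trichotomy s t with hst | hst | hst
  · exact absurd (by rw [map_sub, h, sub_self]) (hψ.map_ne_zero (s := t - s) (by linarith)
      (by linarith))
  · exact hst
  · exact absurd (by rw [map_sub, h, sub_self]) (hψ.map_ne_zero (s := s - t) (by linarith)
      (by linarith))

theorem exists_map_eq (hψ : IsRatCover ψ) {x : G} (hx : x ≠ 0) :
    ∃ s : ℚ, 0 < s ∧ s < 1 ∧ ψ s = x := by
  obtain ⟨q, rfl⟩ := hψ.1 x
  have hfr : ψ (Int.fract q) = ψ q := by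
    rw [Int.fract, map_sub, (hψ.2 _).2 ⟨⌊q⌋, rfl⟩, sub_zero]
  refine ⟨Int.fract q, (Int.fract_nonneg q).lt_of_ne' fun h => hx ?_, Int.fract_lt_one q, hfr⟩
  rw [← hfr, h, map_zero]

theorem isCyclicOrder (hψ : IsRatCover ψ) : IsCyclicOrder (inducedCyclicOrder ψ) := by
  refine ⟨?_, ?_, ?_, ?_, ?_⟩
  · rintro a b c ⟨s, t, hs, hst, ht, hb, hc⟩
    refine ⟨?_, ?_, ?_⟩
    · rintro rfl
      exact hψ.map_ne_zero hs (hst.trans ht) (by simpa using hb)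
    · rintro rfl
      exact hst.ne (hψ.eq_of_map_eq hs (hst.trans ht) (hs.trans hst) ht (hb.trans hc.symm))
    · rintro rfl
      exact hψ.map_ne_zero (hs.trans hst) ht (by simpa using hc)
  · rintro a b c ⟨s, t, hs, hst, ht, hb, hc⟩
    refine ⟨t - s, 1 - s, by linarith, by linarith, by linarith, ?_, ?_⟩
    · rw [map_sub, hb, hc]; abel
    · rw [map_sub, hb, hψ.map_one]; abel
  · rintro a b c d ⟨s, t, hs, hst, ht, hb, hc⟩ ⟨t', u, ht', htu, hu, hc', hd⟩
    obtain rfl := hψ.eq_of_map_eq (hs.trans hst) ht ht' (htu.trans hu) (hc.trans hc'.symm)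
    exact ⟨s, u, hs, hst.trans htu, hu, hb, hd⟩
  · intro a b c hab hbc hca
    obtain ⟨s, hs0, hs1, hs⟩ := hψ.exists_map_eq (sub_ne_zero.2 hab.symm)
    obtain ⟨t, ht0, ht1, ht⟩ := hψ.exists_map_eq (sub_ne_zero.2 hca)
    rcases lt_trichotomy s t with hst | rfl | hst
    · exact Or.inl ⟨s, t, hs0, hst, ht1, hs, ht⟩
    · exact absurd (sub_left_injective (hs.symm.trans ht)) hbc
    · exact Or.inr ⟨t, s, ht0, hst, hs1, ht, hs⟩
  · rintro a b c x ⟨s, t, hs, hst, ht, hb, hc⟩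
    exact ⟨s, t, hs, hst, ht, by simpa using hb, by simpa using hc⟩

theorem nsmul_map_div (hψ : IsRatCover ψ) (k : ℤ) {n : ℕ} (hn : 0 < n) : n • ψ (k / n) = 0 := by
  rw [← map_nsmul, hψ.2]
  exact ⟨k, by rw [nsmul_eq_mul]; field_simp⟩

theorem exists_nsmul_eq_zero (hψ : IsRatCover ψ) (x : G) : ∃ n : ℕ, 0 < n ∧ n • x = 0 := by
  obtain ⟨q, rfl⟩ := hψ.1 x
  refine ⟨q.den, q.den_pos, ?_⟩
  have := hψ.nsmul_map_div q.num q.den_pos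
  rwa [Rat.num_div_den] at this

theorem finite_torsion (hψ : IsRatCover ψ) {n : ℕ} (hn : 0 < n) : {x : G | n • x = 0}.Finite := by
  refine ((Set.finite_Iio n).image fun k : ℕ => ψ ((k : ℚ) / n)).subset fun x hx => ?_
  by_cases hx0 : x = 0
  · exact ⟨0, hn, by simp [hx0]⟩
  obtain ⟨s, hs0, hs1, rfl⟩ := hψ.exists_map_eq hx0
  rw [Set.mem_ofPred_eq, ← map_nsmul, hψ.2] at hx
  obtain ⟨k, hk⟩ := hx
  rw [nsmul_eq_mul] at hk
  have hn' : (0 : ℚ) < n := by exact_mod_cast hn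
  have hk0 : 0 < k := by
    have : (0 : ℚ) < k := by rw [hk]; positivity
    exact_mod_cast this
  have hkn : k < n := by
    have : (k : ℚ) < n := by rw [hk]; nlinarith
    exact_mod_cast this
  lift k to ℕ using hk0.le
  refine ⟨k, by simpa using hkn, ?_⟩
  have : s = (k : ℚ) / n := by rw [eq_div_iff hn'.ne']; push_cast at hk; linarith
  simp [this]

theorem addOrderOf_map_one_div (hψ : IsRatCover ψ) {n : ℕ} (hn : 0 < n) :
    addOrderOf (ψ (1 / n)) = n := by
  rw [addOrderOf_eq_iff hn]
  refine ⟨by simpa using hψ.nsmul_map_div 1 hn, fun m hmn hm => ?_⟩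
  have hn' : (0 : ℚ) < n := by exact_mod_cast hn
  have hm' : (0 : ℚ) < m := by exact_mod_cast hm
  rw [← map_nsmul]
  refine hψ.map_ne_zero (by rw [nsmul_eq_mul]; positivity) ?_
  rw [nsmul_eq_mul, mul_one_div, div_lt_one hn']
  exact_mod_cast hmn

end IsRatCover

/-- `g` is the element `1/n` of `G`, as seen by the cyclic order `R`. -/
def IsCyclicUnit {G : Type*} [AddCommGroup G] (R : G → G → G → Prop) (n : ℕ) (g : G) : Prop :=
  addOrderOf g = n ∧ (∀ x, n • x = 0 → ∃ k < n, k • g = x) ∧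
    ∀ j k, 0 < j → j < k → k < n → R 0 (j • g) (k • g)

theorem IsRatCover.exists_isCyclicUnit {G : Type*} [AddCommGroup G] {ψ : ℚ →+ G}
    (hψ : IsRatCover ψ) {R : G → G → G → Prop} (h : IsCyclicOrder R) {n : ℕ} (hn : 0 < n) :
    ∃ g, IsCyclicUnit R n g := by
  let T : AddSubgroup G := (nsmulAddMonoidHom n : G →+ G).ker
  have hT : ∀ x, x ∈ T ↔ n • x = 0 := fun x => Iff.rfl
  obtain ⟨g, hg, hgen, hord⟩ := h.exists_generator T (hψ.finite_torsion hn)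
  have key : addOrderOf g = n := by
    refine Nat.dvd_antisymm (addOrderOf_dvd_of_nsmul_eq_zero ((hT g).1 hg)) ?_
    obtain ⟨k, -, hk⟩ := hgen (ψ (1 / n)) ((hT _).2 (by simpa using hψ.nsmul_map_div 1 hn))
    rw [← hψ.addOrderOf_map_one_div hn, ← hk]
    exact addOrderOf_smul_dvd k
  rw [key] at hgen hord
  exact ⟨g, key, fun x hx => hgen x hx, hord⟩

theorem IsCyclicUnit.nsmul_eq {G : Type*} [AddCommGroup G] {R : G → G → G → Prop}
    (h : IsCyclicOrder R) {m n : ℕ} (hm : 0 < m) (hn : 0 < n) {g g' : G}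
    (hg : IsCyclicUnit R n g) (hg' : IsCyclicUnit R (m * n) g') : m • g' = g := by
  obtain ⟨hgo, hgs, hgR⟩ := hg
  obtain ⟨hgo', hgs', hgR'⟩ := hg'
  have hng : n • g = 0 := by rw [← hgo, addOrderOf_nsmul_eq_zero]
  have hmng' : (m * n) • g' = 0 := by rw [← hgo', addOrderOf_nsmul_eq_zero]
  obtain ⟨i, hi, hig⟩ := hgs (m • g') (by rw [← mul_nsmul]; exact hmng')
  obtain ⟨k, hk, hkg⟩ := hgs' g (by rw [mul_comm, mul_nsmul, hng, nsmul_zero])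
  obtain ⟨j, rfl⟩ : m ∣ k := by
    have : m * n ∣ k * n := by
      rw [← hgo', addOrderOf_dvd_iff_nsmul_eq_zero, mul_nsmul, hkg, hng]
    exact Nat.dvd_of_mul_dvd_mul_right hn this
  rcases Nat.lt_trichotomy j 1 with hj | rfl | hj
  · obtain rfl : j = 0 := by omega
    have : g = 0 := by simpa using hkg.symm
    rw [← hig, this, nsmul_zero]
  · simpa using hkg
  · rcases Nat.lt_trichotomy i 1 with hi1 | rfl | hi1
    · obtain rfl : i = 0 := by omega
      have h0 : m • g' = 0 := by simpa using hig.symm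
      rw [h0, ← hkg, mul_nsmul, h0, nsmul_zero]
    · simpa using hig.symm
    · have h₁ := hgR' m (m * j) hm (by nlinarith) hk
      have h₂ := hgR 1 i one_pos hi1 hi
      rw [hkg, ← hig] at h₁
      rw [one_nsmul] at h₂
      exact absurd h₁ (h.asymm h₂)

/-- Every cyclic order on a copy of `ℚ/ℤ` is transported from the natural one. -/
theorem IsCyclicOrder.exists_cover {G : Type*} [AddCommGroup G] {ψ₀ : ℚ →+ G}
    (hψ₀ : IsRatCover ψ₀) {R : G → G → G → Prop} (h : IsCyclicOrder R) :
    ∃ ψ : ℚ →+ G, IsRatCover ψ ∧ ∀ a b c, R a b c ↔ inducedCyclicOrder ψ a b c := by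
  choose! g hg using fun (n : ℕ) (hn : 0 < n) => hψ₀.exists_isCyclicUnit h hn
  have hsmul : ∀ m n : ℕ, 0 < m → 0 < n → m • g (m * n) = g n := fun m n hm hn =>
    IsCyclicUnit.nsmul_eq h hm hn (hg n hn) (hg (m * n) (by positivity))
  let f : ℚ → G := fun q => q.num • g q.den
  have hf : ∀ (k : ℤ) (n : ℕ), 0 < n → f (k / n) = k • g n := by
    intro k n hn
    obtain ⟨c, hk, hc⟩ := Rat.num_den_mk (q := (k : ℚ) / n) (n := k) (d := n) (by omega)
      (by simp [Rat.divInt_eq_div])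
    have hd := ((k : ℚ) / n).den_pos
    have hc0 : 0 < c := by
      by_contra hneg
      have : c * (((k : ℚ) / n).den : ℤ) ≤ 0 :=
        mul_nonpos_of_nonpos_of_nonneg (by omega) (by omega)
      omega
    lift c to ℕ using hc0.le
    have hc' : n = c * ((k : ℚ) / n).den := by exact_mod_cast hc
    have := hsmul c _ (by omega) hd
    rw [← hc'] at this
    simp only [f]
    rw [← this]
    conv_rhs => rw [hk]
    rw [mul_comm, mul_zsmul, natCast_zsmul]
  have hadd : ∀ p q, f (p + q) = f p + f q := by
    intro p q
    have hp := p.den_pos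
    have hq := q.den_pos
    have hp' : (p.den : ℚ) ≠ 0 := by positivity
    have hq' : (q.den : ℚ) ≠ 0 := by positivity
    have hpq : 0 < p.den * q.den := by positivity
    have e₁ : p = ((p.num * q.den : ℤ) : ℚ) / (p.den * q.den : ℕ) := by
      conv_lhs => rw [← Rat.num_div_den p]
      push_cast; field_simp
    have e₂ : q = ((q.num * p.den : ℤ) : ℚ) / (p.den * q.den : ℕ) := by
      conv_lhs => rw [← Rat.num_div_den q]
      push_cast; field_simp
    have e₃ : p + q = ((p.num * q.den + q.num * p.den : ℤ) : ℚ) / (p.den * q.den : ℕ) := by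
      refine (congrArg₂ (· + ·) e₁ e₂).trans ?_
      push_cast; ring
    rw [e₃, hf _ _ hpq, add_zsmul, ← hf _ _ hpq, ← hf _ _ hpq, ← e₁, ← e₂]
  let ψ : ℚ →+ G := AddMonoidHom.mk' f hadd
  have hψdiv : ∀ (k n : ℕ), 0 < n → ψ (k / n) = k • g n := by
    intro k n hn
    exact (hf k n hn).trans (natCast_zsmul _ _)
  have hψ : IsRatCover ψ := by
    refine ⟨fun x => ?_, fun q => ⟨fun hq => ?_, ?_⟩⟩
    · obtain ⟨n, hn, hx⟩ := hψ₀.exists_nsmul_eq_zero x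
      obtain ⟨k, -, hk⟩ := (hg n hn).2.1 x hx
      exact ⟨k / n, (hψdiv k n hn).trans hk⟩
    · have hq : q.num • g q.den = 0 := hq
      rw [← addOrderOf_dvd_iff_zsmul_eq_zero, (hg _ q.den_pos).1] at hq
      obtain ⟨c, hc⟩ := hq
      refine ⟨c, ?_⟩
      conv_rhs => rw [← Rat.num_div_den q]
      rw [hc]
      push_cast
      field_simp
    · rintro ⟨n, rfl⟩
      have h1 : g 1 = 0 := AddMonoid.addOrderOf_eq_one_iff.1 (hg 1 one_pos).1
      change f n = 0
      simpa [h1] using hf n 1 one_pos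
  refine ⟨ψ, hψ, h.iff_of_imp hψ.isCyclicOrder fun a b c habc => ?_⟩
  obtain ⟨hab, hbc, hca⟩ := h.1 a b c habc
  obtain ⟨n₁, hn₁, hx₁⟩ := hψ₀.exists_nsmul_eq_zero (b - a)
  obtain ⟨n₂, hn₂, hx₂⟩ := hψ₀.exists_nsmul_eq_zero (c - a)
  have hn : 0 < n₁ * n₂ := by positivity
  obtain ⟨-, hgen, hord⟩ := hg (n₁ * n₂) hn
  obtain ⟨j, hj, hjb⟩ := hgen (b - a) (by rw [mul_nsmul, hx₁, nsmul_zero])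
  obtain ⟨k, hk, hkc⟩ := hgen (c - a) (by rw [mul_comm, mul_nsmul, hx₂, nsmul_zero])
  have habc' : R 0 (j • g (n₁ * n₂)) (k • g (n₁ * n₂)) := by
    have := h.translate habc (-a)
    rwa [add_neg_cancel, ← sub_eq_add_neg, ← sub_eq_add_neg, ← hjb, ← hkc] at this
  obtain ⟨h0j, hjk, hk0⟩ := h.1 _ _ _ habc'
  have hj0 : 0 < j := Nat.pos_of_ne_zero fun e => h0j (by simp [e])
  have hk0 : 0 < k := Nat.pos_of_ne_zero fun e => hk0 (by simp [e])
  have hlt : j < k := by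
    rcases Nat.lt_trichotomy j k with hlt | heq | hgt
    · exact hlt
    · exact absurd (by rw [heq]) hjk
    · exact absurd (hord k j hk0 hgt hj) (h.asymm habc')
  have hnQ : (0 : ℚ) < (n₁ * n₂ : ℕ) := by exact_mod_cast hn
  refine ⟨(j : ℚ) / (n₁ * n₂ : ℕ), (k : ℚ) / (n₁ * n₂ : ℕ), ?_, ?_, ?_, ?_, ?_⟩
  · have : (0 : ℚ) < j := by exact_mod_cast hj0
    positivity
  · gcongr
  · rw [div_lt_one hnQ]
    exact_mod_cast hk
  · rw [hψdiv _ _ hn, hjb]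
  · rw [hψdiv _ _ hn, hkc]

/-- Two covers of the same group differ by an automorphism. -/
theorem IsRatCover.exists_addEquiv {G : Type*} [AddCommGroup G] {ψ ψ' : ℚ →+ G}
    (hψ : IsRatCover ψ) (hψ' : IsRatCover ψ') : ∃ φ : G ≃+ G, ∀ q, φ (ψ q) = ψ' q := by
  have hker : ψ.ker = ψ'.ker := by
    ext q
    rw [AddMonoidHom.mem_ker, AddMonoidHom.mem_ker, hψ.2, hψ'.2]
  refine ⟨((QuotientAddGroup.quotientKerEquivOfSurjective ψ hψ.1).symm.trans
    (QuotientAddGroup.quotientAddEquivOfEq hker)).trans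
    (QuotientAddGroup.quotientKerEquivOfSurjective ψ' hψ'.1), fun q => ?_⟩
  have : (QuotientAddGroup.quotientKerEquivOfSurjective ψ hψ.1).symm (ψ q) =
      (q : ℚ ⧸ ψ.ker) := by
    rw [AddEquiv.symm_apply_eq]
    rfl
  simp only [AddEquiv.trans_apply, this]
  rfl

/-- Integers congruent to prescribed values modulo high powers of all small primes. -/
theorem exists_int_forall_prime_pow_dvd_sub (ε : ℕ → ℤ) (N : ℕ) :
    ∃ a : ℤ, ∀ p ≤ N, p.Prime → (p : ℤ) ^ N ∣ a - ε p := by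
  have hI : Pairwise fun p q : {p : Fin (N + 1) // (p : ℕ).Prime} =>
      IsCoprime (Ideal.span {((p : ℕ) : ℤ) ^ N}) (Ideal.span {((q : ℕ) : ℤ) ^ N}) := by
    intro p q hpq
    rw [Ideal.isCoprime_span_singleton_iff]
    refine IsCoprime.pow (Nat.isCoprime_iff_coprime.2 ((Nat.coprime_primes p.2 q.2).2 ?_))
    exact fun h => hpq (Subtype.ext (Fin.ext h))
  obtain ⟨a, ha⟩ := Ideal.exists_forall_sub_mem_ideal hI fun p => ε p
  refine ⟨a, fun p hp hpp => ?_⟩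
  rw [← Ideal.mem_span_singleton]
  exact ha ⟨⟨p, by omega⟩, hpp⟩

theorem natCast_dvd_of_forall_prime_pow_dvd {m N : ℕ} (hm : 0 < m) (hmN : m ≤ N) {z : ℤ}
    (hz : ∀ p ≤ N, p.Prime → (p : ℤ) ^ N ∣ z) : (m : ℤ) ∣ z := by
  rw [Int.natCast_dvd, Nat.dvd_iff_prime_pow_dvd_dvd]
  intro p k hp hpk
  have hle := Nat.le_of_dvd hm hpk
  have hkN : k ≤ N := (Nat.lt_pow_self hp.one_lt).le.trans (hle.trans hmN)
  rcases Nat.eq_zero_or_pos k with rfl | hk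
  · simp
  have hpN : p ≤ N := (Nat.le_self_pow hk.ne' p).trans (hle.trans hmN)
  rw [← Int.natCast_dvd]
  push_cast
  exact (pow_dvd_pow _ hkN).trans (hz p hpN hp)

/-- On a torsion group, one may choose the sign of an involution independently on each primary
component. -/
theorem exists_involution_of_signs {G : Type*} [AddCommGroup G]
    (htor : ∀ x : G, 0 < addOrderOf x) (ε : ℕ → ℤ) (hε : ∀ p, ε p * ε p = 1) :
    ∃ F : G →+ G, (∀ x, F (F x) = x) ∧
      ∀ x p, p.Prime → addOrderOf x = p → F x = ε p • x := by
  choose a ha using exists_int_forall_prime_pow_dvd_sub ε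
  have hsub : ∀ m N : ℕ, 0 < m → m ≤ N → (m : ℤ) ∣ a m - a N := fun m N hm hmN =>
    natCast_dvd_of_forall_prime_pow_dvd hm le_rfl fun p hp hpp => by
      have h₁ := ha m p hp hpp
      have h₂ := (pow_dvd_pow (p : ℤ) hmN).trans (ha N p (hp.trans hmN) hpp)
      simpa using dvd_sub h₁ h₂
  have hval : ∀ (x : G) N, addOrderOf x ≤ N → a (addOrderOf x) • x = a N • x := by
    intro x N hN
    rw [← sub_eq_zero, ← sub_smul, ← addOrderOf_dvd_iff_zsmul_eq_zero]
    exact hsub _ N (htor x) hN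
  let F : G →+ G := AddMonoidHom.mk' (fun x => a (addOrderOf x) • x) fun x y => by
    have hx := hval x (addOrderOf x + addOrderOf y + addOrderOf (x + y)) (by omega)
    have hy := hval y (addOrderOf x + addOrderOf y + addOrderOf (x + y)) (by omega)
    have hxy := hval (x + y) (addOrderOf x + addOrderOf y + addOrderOf (x + y)) (by omega)
    rw [hx, hy, hxy, zsmul_add]
  have hF : ∀ x, F x = a (addOrderOf x) • x := fun _ => rfl
  refine ⟨F, fun x => ?_, fun x p hp hx => ?_⟩
  · rw [hF x, map_zsmul, hF x, ← mul_zsmul, ← sub_eq_zero]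
    nth_rewrite 4 [← one_zsmul x]
    rw [← sub_smul, ← addOrderOf_dvd_iff_zsmul_eq_zero]
    refine natCast_dvd_of_forall_prime_pow_dvd (htor x) le_rfl fun p hp hpp => ?_
    have := (ha _ p hp hpp).mul_right (a (addOrderOf x) + ε p)
    rwa [show (a (addOrderOf x) - ε p) * (a (addOrderOf x) + ε p) =
      a (addOrderOf x) * a (addOrderOf x) - 1 by linear_combination -hε p] at this
  · rw [hF, hx, ← sub_eq_zero, ← sub_smul, ← addOrderOf_dvd_iff_zsmul_eq_zero, hx]
    exact (dvd_pow_self _ hp.ne_zero).trans (ha p p le_rfl hp)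

/-- A copy of `ℚ/ℤ` carries uncountably many cyclic orders. -/
theorem IsRatCover.not_countable {G : Type*} [AddCommGroup G] {ψ : ℚ →+ G}
    (hψ : IsRatCover ψ) : ¬ Set.Countable {R : G → G → G → Prop | IsCyclicOrder R} := by
  classical
  intro hcount
  obtain ⟨e, he⟩ := hcount.exists_eq_range ⟨_, hψ.isCyclicOrder⟩
  have htor : ∀ x : G, 0 < addOrderOf x := fun x => by
    obtain ⟨n, hn, hx⟩ := hψ.exists_nsmul_eq_zero x
    exact (isOfFinAddOrder_iff_nsmul_eq_zero.2 ⟨n, hn, hx⟩).addOrderOf_pos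
  let x : ℕ → G := fun p => ψ (1 / p)
  let π : ℕ → ℕ := fun n => Nat.nth Nat.Prime (n + 1)
  have hπ : ∀ n, (π n).Prime := fun n => Nat.prime_nth_prime _
  have hπinj : Function.Injective π := fun m n h => by
    simpa using Nat.nth_injective Nat.infinite_setOfPred_prime h
  have hπ2 : ∀ n, 2 < π n := fun n => by
    have : Nat.nth Nat.Prime 0 < π n := Nat.nth_strictMono Nat.infinite_setOfPred_prime n.succ_pos
    have := (Nat.prime_nth_prime 0).two_le
    omega
  -- The diagonal order disagrees with `e n` on the triple `0, x (π n), -x (π n)`.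
  let ε : ℕ → ℤ := fun p => if ∃ n, π n = p ∧ e n 0 (x p) (-x p) then -1 else 1
  obtain ⟨F, hFF, hFx⟩ := exists_involution_of_signs htor ε fun p => by
    simp only [ε]; split_ifs <;> norm_num
  have hψF : IsRatCover (F.comp ψ) := by
    refine ⟨fun y => ?_, fun q => ?_⟩
    · obtain ⟨q, hq⟩ := hψ.1 (F y)
      exact ⟨q, by simp [hq, hFF]⟩
    · rw [← hψ.2, AddMonoidHom.comp_apply]
      exact ⟨fun h => by rw [← hFF (ψ q), h, map_zero], fun h => by rw [h, map_zero]⟩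
  have hmem : inducedCyclicOrder (F.comp ψ) ∈ Set.range e := he ▸ hψF.isCyclicOrder
  obtain ⟨n, hn⟩ := hmem
  have hFp := hFx (x (π n)) (π n) (hπ n) (hψ.addOrderOf_map_one_div (hπ n).pos)
  have hp : (2 : ℚ) < π n := by exact_mod_cast hπ2 n
  have hhalf : (1 : ℚ) / π n < 1 / 2 := one_div_lt_one_div_of_lt (by norm_num) hp
  have hpos : (0 : ℚ) < 1 / π n := by positivity
  have hstd : inducedCyclicOrder (F.comp ψ) 0 (F (x (π n))) (-F (x (π n))) := by
    refine ⟨1 / π n, 1 - 1 / π n, hpos, by linarith, by linarith, ?_, ?_⟩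
    · simp [x]
    · rw [map_sub, hψF.map_one]
      simp [x]
  by_cases hen : e n 0 (x (π n)) (-x (π n))
  · have hε : ε (π n) = -1 := if_pos ⟨n, rfl, hen⟩
    rw [hFp, hε, neg_one_zsmul, neg_neg] at hstd
    rw [hn] at hen
    exact hψF.isCyclicOrder.asymm hen hstd
  · have hε : ε (π n) = 1 := if_neg fun ⟨m, hm, hem⟩ => hen (hπinj hm ▸ hem)
    rw [hFp, hε, one_zsmul, ← hn] at hstd
    exact hen hstd

/-- If `Γ` is an abelian group isomorphic to `ℚ/ℤ`, then (a) the set of cyclic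
orders on `Γ` is uncountable, and (b) any two cyclic orders on `Γ` are c-isomorphic. -/
theorem cyclic_orders_on_QmodZ
    {Γ : Type*} [AddCommGroup Γ]
    (hΓ : Nonempty (Γ ≃+ (ℚ ⧸ AddSubgroup.zmultiples (1 : ℚ)))) :
    (¬ Set.Countable {R : Γ → Γ → Γ → Prop | IsCyclicOrder R}) ∧
    (∀ R R' : Γ → Γ → Γ → Prop, IsCyclicOrder R → IsCyclicOrder R' →
      ∃ φ : Γ ≃+ Γ, ∀ a b c : Γ, R a b c ↔ R' (φ a) (φ b) (φ c)) := by
  obtain ⟨e⟩ := hΓ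
  let ψ : ℚ →+ Γ := e.symm.toAddMonoidHom.comp (QuotientAddGroup.mk' _)
  have hψ : IsRatCover ψ := by
    refine ⟨e.symm.surjective.comp (QuotientAddGroup.mk'_surjective _), fun q => ?_⟩
    simp [ψ, AddSubgroup.mem_zmultiples_iff]
  refine ⟨hψ.not_countable, fun R R' h h' => ?_⟩
  obtain ⟨ψ₁, hψ₁, hR⟩ := h.exists_cover hψ
  obtain ⟨ψ₂, hψ₂, hR'⟩ := h'.exists_cover hψ
  obtain ⟨φ, hφ⟩ := hψ₁.exists_addEquiv hψ₂
  refine ⟨φ, fun a b c => ?_⟩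
  rw [hR, hR']
  simp only [inducedCyclicOrder, ← hφ, ← map_sub, φ.injective.eq_iff]
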